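/- arXiv:1306.4350 — 3 statements merged into one kernel-verified Lean document; each statement's English description precedes it below -/
import Mathlib

section
/- Let A_1,…,A_{K+1} be n×n invertible complex matrices with equal determinants, and define B_k = A_k A_{K+1}^{-1} for k = 1,…,K. Then the following two statements are equivalent: (1) there exist n×n unitary matrices U_1,…,U_K,U_{K+1} such that U_k† B_k U_{K+1} is upper-triangular with all diagonal entries equal to 1 for every k = 1,…,K; (2) there exist n×n unitary matrices U_1,…,U_{K+1},V such that U_k† A_k V = R_k is upper-triangular for every k = 1,…,K+1, where the matrices R_1,…,R_{K+1} have equal diagonals, i.e. [R_1]_{jj} = ⋯ = [R_{K+1}]_{jj} for all j = 1,…,n. -/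
open Matrix BigOperators

namespace Matrix

/-- The diagonal of a product of upper triangular matrices is the product of the diagonals. -/
theorem BlockTriangular.mul_apply_diag {m R : Type*} [Fintype m] [LinearOrder m]
    [NonUnitalNonAssocSemiring R] {M N : Matrix m m R}
    (hM : M.BlockTriangular id) (hN : N.BlockTriangular id) (j : m) :
    (M * N) j j = M j j * N j j := by
  rw [mul_apply]
  refine Finset.sum_eq_single j (fun i _ hij => ?_) (fun h => absurd (Finset.mem_univ j) h)
  rcases lt_or_gt_of_ne hij with h | h
  · rw [hM h, zero_mul]
  · rw [hN h, mul_zero]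

/-- The diagonal entries of an invertible upper triangular matrix do not vanish. -/
theorem BlockTriangular.apply_diag_ne_zero {m R : Type*} [Fintype m] [LinearOrder m]
    [CommRing R] [Nontrivial R] {M : Matrix m m R}
    (hM : M.BlockTriangular id) (hdet : IsUnit M.det) (j : m) : M j j ≠ 0 := by
  rw [det_of_isUpperTriangular hM] at hdet
  exact (isUnit_of_dvd_unit (Finset.dvd_prod_of_mem _ (Finset.mem_univ j)) hdet).ne_zero

/-- The inverse of an upper triangular matrix is upper triangular. -/
theorem BlockTriangular.inv_of_isUnit_det {m R : Type*} [Fintype m] [LinearOrder m]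
    [CommRing R] {M : Matrix m m R}
    (hM : M.BlockTriangular id) (hdet : IsUnit M.det) : M⁻¹.BlockTriangular id :=
  have := M.invertibleOfIsUnitDet hdet
  blockTriangular_inv_of_blockTriangular hM

/-- **QR decomposition**: every square matrix becomes upper triangular after left multiplication by
a suitable unitary matrix. -/
theorem exists_unitary_mul_blockTriangular {m 𝕜 : Type*} [Fintype m] [LinearOrder m]
    [LocallyFiniteOrderBot m] [WellFoundedLT m] [RCLike 𝕜] (M : Matrix m m 𝕜) :
    ∃ W ∈ unitaryGroup m 𝕜, (W * M).BlockTriangular id := by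
  let f : m → EuclideanSpace 𝕜 m := fun j => WithLp.toLp 2 (M.col j)
  let e := EuclideanSpace.basisFun m 𝕜
  let b := InnerProductSpace.gramSchmidtOrthonormalBasis (finrank_euclideanSpace (𝕜 := 𝕜)) f
  have hM : e.toBasis.toMatrix f = M := by
    ext i j
    simp [e, f, Module.Basis.toMatrix_apply]
  refine ⟨b.toBasis.toMatrix e, b.toMatrix_orthonormalBasis_mem_unitary e, ?_⟩
  have h := b.toBasis.toMatrix_mul_toMatrix e.toBasis f
  rw [hM, OrthonormalBasis.coe_toBasis] at h
  rw [h]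
  exact InnerProductSpace.gramSchmidtOrthonormalBasis_inv_isUpperTriangular _ f

/-- **RQ decomposition**: every invertible square matrix becomes upper triangular after right
multiplication by a suitable unitary matrix. -/
theorem exists_mul_unitary_blockTriangular {m 𝕜 : Type*} [Fintype m] [LinearOrder m]
    [LocallyFiniteOrderBot m] [WellFoundedLT m] [RCLike 𝕜] (M : Matrix m m 𝕜)
    (hM : IsUnit M.det) :
    ∃ V ∈ unitaryGroup m 𝕜, (M * V).BlockTriangular id := by
  obtain ⟨W, hW, hT⟩ := exists_unitary_mul_blockTriangular M⁻¹
  refine ⟨star W, Unitary.star_mem hW, ?_⟩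
  have hinv : (W * M⁻¹)⁻¹ = M * star W := by
    rw [mul_inv_rev, nonsing_inv_nonsing_inv _ hM,
      inv_eq_left_inv (mem_unitaryGroup_iff'.mp hW)]
  rw [← hinv]
  refine hT.inv_of_isUnit_det ?_
  rw [det_mul]
  exact (isUnit_det_of_left_inverse (mem_unitaryGroup_iff'.mp hW)).mul
    (isUnit_nonsing_inv_det _ hM)

end Matrix

/-- **Equivalence of `K`-GMD and `(K+1)`-JET (square case).**
Let `A 0, …, A K` be invertible `n × n` complex matrices with equal determinants and let
`B k = A k * (A K)⁻¹` for `k < K`.  Then there exist unitary matrices `U 0, …, U K` such that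
every `(U k)ᴴ * B k * (U K)` is upper triangular with unit diagonal iff there exist unitary
matrices `U 0, …, U K, V` such that every `(U k)ᴴ * A k * V` is upper triangular and all these
triangular matrices have the same diagonal. -/
theorem kGMD_iff_succJET {n K : ℕ} (A : Fin (K + 1) → Matrix (Fin n) (Fin n) ℂ)
    (hinv : ∀ k, IsUnit (A k).det)
    (hdet : ∀ k l, (A k).det = (A l).det) :
    (∃ U : Fin (K + 1) → Matrix (Fin n) (Fin n) ℂ,
        (∀ k, U k ∈ Matrix.unitaryGroup (Fin n) ℂ) ∧
        ∀ k : Fin K,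
          ((U k.castSucc)ᴴ * (A k.castSucc * (A (Fin.last K))⁻¹) *
              U (Fin.last K)).BlockTriangular id ∧
          ∀ j, ((U k.castSucc)ᴴ * (A k.castSucc * (A (Fin.last K))⁻¹) * U (Fin.last K)) j j
              = 1) ↔
      (∃ (U : Fin (K + 1) → Matrix (Fin n) (Fin n) ℂ) (V : Matrix (Fin n) (Fin n) ℂ),
        (∀ k, U k ∈ Matrix.unitaryGroup (Fin n) ℂ) ∧ V ∈ Matrix.unitaryGroup (Fin n) ℂ ∧
        (∀ k, ((U k)ᴴ * A k * V).BlockTriangular id) ∧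
        ∀ k l j, ((U k)ᴴ * A k * V) j j = ((U l)ᴴ * A l * V) j j) := by
  have hU_det : ∀ {W : Matrix (Fin n) (Fin n) ℂ}, W ∈ Matrix.unitaryGroup (Fin n) ℂ →
      IsUnit W.det ∧ IsUnit Wᴴ.det := fun hW =>
    ⟨isUnit_det_of_left_inverse (mem_unitaryGroup_iff'.mp hW),
      isUnit_det_of_left_inverse (mem_unitaryGroup_iff.mp hW)⟩
  have factor : ∀ (k : Fin (K + 1)) (P Q V : Matrix (Fin n) (Fin n) ℂ),
      Q ∈ Matrix.unitaryGroup (Fin n) ℂ →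
      Pᴴ * A k * V =
        (Pᴴ * (A k * (A (Fin.last K))⁻¹) * Q) * (Qᴴ * A (Fin.last K) * V) := by
    intro k P Q V hQ
    have hQQ : Q * Qᴴ = 1 := mem_unitaryGroup_iff.mp hQ
    calc Pᴴ * A k * V
        = Pᴴ * A k * ((A (Fin.last K))⁻¹ * (Q * Qᴴ) * A (Fin.last K)) * V := by
          rw [hQQ, mul_one, nonsing_inv_mul _ (hinv _), mul_one]
      _ = _ := by simp only [mul_assoc]
  constructor
  · rintro ⟨U, hU, hT⟩
    obtain ⟨V, hV, hR⟩ := exists_mul_unitary_blockTriangular ((U (Fin.last K))ᴴ * A (Fin.last K))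
      (by rw [det_mul]; exact (hU_det (hU _)).2.mul (hinv _))
    have key : ∀ k, ((U k)ᴴ * A k * V).BlockTriangular id ∧
        ∀ j, ((U k)ᴴ * A k * V) j j = ((U (Fin.last K))ᴴ * A (Fin.last K) * V) j j := by
      intro k
      induction k using Fin.lastCases with
      | last => exact ⟨hR, fun _ => rfl⟩
      | cast k =>
        rw [factor k.castSucc _ _ V (hU (Fin.last K))]
        refine ⟨(hT k).1.mul hR, fun j => ?_⟩
        rw [(hT k).1.mul_apply_diag hR, (hT k).2 j, one_mul]
    exact ⟨U, V, hU, hV, fun k => (key k).1, fun k l j => ((key k).2 j).trans ((key l).2 j).symm⟩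
  · rintro ⟨U, V, hU, hV, hR, hd⟩
    refine ⟨U, hU, fun k => ?_⟩
    have hL := hR (Fin.last K)
    have hL_det : IsUnit ((U (Fin.last K))ᴴ * A (Fin.last K) * V).det := by
      rw [det_mul, det_mul]
      exact ((hU_det (hU _)).2.mul (hinv _)).mul (hU_det hV).1
    have hfac := factor k.castSucc (U k.castSucc) _ V (hU (Fin.last K))
    have hT : ((U k.castSucc)ᴴ * (A k.castSucc * (A (Fin.last K))⁻¹) *
        U (Fin.last K)).BlockTriangular id := by
      have h := (hR k.castSucc).mul (hL.inv_of_isUnit_det hL_det)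
      rwa [hfac, mul_nonsing_inv_cancel_right _ _ hL_det] at h
    refine ⟨hT, fun j => ?_⟩
    have h := hd k.castSucc (Fin.last K) j
    rw [hfac, hT.mul_apply_diag hL] at h
    exact mul_eq_right₀ (hL.apply_diag_ne_zero hL_det j) |>.mp h
end

section
/- Let A_1 and A_2 be complex 2×2 matrices with det A_1 = det A_2 = 1. Then there exist 2×2 complex unitary matrices U_1, U_2, V such that both U_1† A_1 V and U_2† A_2 V are upper-triangular with both diagonal entries equal to 1, if and only if F_1(A_1†A_1 − I, A_2†A_2 − I) ≥ 0. -/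
open Matrix ComplexOrder

/-- `F₁(S₁, S₂) = det (S₁ · adj(S₂) − S₂ · adj(S₁))`. -/
noncomputable def F1 {n : ℕ} (S₁ S₂ : Matrix (Fin n) (Fin n) ℂ) : ℂ :=
  (S₁ * S₂.adjugate - S₂ * S₁.adjugate).det

/-- The Hermitian matrix `t·I + x·σ₁ + y·σ₂ + z·σ₃`, where `σ₁, σ₂, σ₃` are the Pauli matrices. -/
noncomputable def pauliMatrix (t x y z : ℝ) : Matrix (Fin 2) (Fin 2) ℂ :=
  !![⟨t + z, 0⟩, ⟨x, -y⟩; ⟨x, y⟩, ⟨t - z, 0⟩]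

theorem Matrix.IsHermitian.exists_eq_pauliMatrix {S : Matrix (Fin 2) (Fin 2) ℂ}
    (hS : S.IsHermitian) : ∃ t x y z : ℝ, S = pauliMatrix t x y z := by
  have h00 := congrArg Complex.im (hS.apply 0 0)
  have h11 := congrArg Complex.im (hS.apply 1 1)
  have h01r := congrArg Complex.re (hS.apply 0 1)
  have h01i := congrArg Complex.im (hS.apply 0 1)
  simp only [Complex.star_def, Complex.conj_re, Complex.conj_im] at h00 h11 h01r h01i
  refine ⟨((S 0 0).re + (S 1 1).re) / 2, (S 1 0).re, (S 1 0).im,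
    ((S 0 0).re - (S 1 1).re) / 2, ?_⟩
  ext i j
  fin_cases i <;> fin_cases j <;> apply Complex.ext <;> simp [pauliMatrix] <;> linarith

theorem F1_pauliMatrix (t₁ x₁ y₁ z₁ t₂ x₂ y₂ z₂ : ℝ) :
    F1 (pauliMatrix t₁ x₁ y₁ z₁) (pauliMatrix t₂ x₂ y₂ z₂) =
      ((4 * ((y₁ * z₂ - z₁ * y₂) ^ 2 + (z₁ * x₂ - x₁ * z₂) ^ 2 + (x₁ * y₂ - y₁ * x₂) ^ 2 -
        ((t₂ * x₁ - t₁ * x₂) ^ 2 + (t₂ * y₁ - t₁ * y₂) ^ 2 + (t₂ * z₁ - t₁ * z₂) ^ 2)) : ℝ) :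
          ℂ) := by
  unfold F1 pauliMatrix
  rw [Matrix.adjugate_fin_two_of, Matrix.adjugate_fin_two_of, Matrix.det_fin_two]
  apply Complex.ext
  · rw [Complex.ofReal_re]
    simp
    ring
  · rw [Complex.ofReal_im]
    simp
    ring

/-- If `det A = 1`, then `AᴴA - I` has nonnegative trace and determinant minus its trace. -/
theorem exists_conjTranspose_mul_self_sub_one_eq_pauliMatrix {A : Matrix (Fin 2) (Fin 2) ℂ}
    (hA : A.det = 1) :
    ∃ t x y z : ℝ, Aᴴ * A - 1 = pauliMatrix t x y z ∧ 0 ≤ t ∧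
      x ^ 2 + y ^ 2 + z ^ 2 = t ^ 2 + 2 * t := by
  obtain ⟨t, x, y, z, h⟩ :=
    ((Matrix.isHermitian_conjTranspose_mul_self A).sub
      Matrix.isHermitian_one).exists_eq_pauliMatrix
  have hP : Aᴴ * A = pauliMatrix t x y z + 1 := by rw [← h]; abel
  have hdet : (pauliMatrix t x y z + 1).det = 1 := by
    rw [← hP, Matrix.det_mul, Matrix.det_conjTranspose, hA]; simp
  have hnorm := congrArg Complex.re hdet
  have h00 := congrArg Complex.re (congrFun (congrFun hP 0) 0)
  have h11 := congrArg Complex.re (congrFun (congrFun hP 1) 1)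
  simp [Matrix.det_fin_two, pauliMatrix] at hnorm
  simp [Matrix.mul_apply, Fin.sum_univ_two, pauliMatrix] at h00 h11
  have htr : 0 ≤ t + 1 := by
    linarith [mul_self_nonneg (A 0 0).re, mul_self_nonneg (A 0 0).im,
      mul_self_nonneg (A 1 0).re, mul_self_nonneg (A 1 0).im,
      mul_self_nonneg (A 0 1).re, mul_self_nonneg (A 0 1).im,
      mul_self_nonneg (A 1 1).re, mul_self_nonneg (A 1 1).im]
  refine ⟨t, x, y, z, h, ?_, by linarith⟩
  nlinarith [sq_nonneg x, sq_nonneg y, sq_nonneg z]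

theorem conjTranspose_mul_pauliMatrix_mul_apply_zero_zero (t x y z : ℝ)
    (V : Matrix (Fin 2) (Fin 2) ℂ) (hV : Complex.normSq (V 0 0) + Complex.normSq (V 1 0) = 1) :
    (Vᴴ * pauliMatrix t x y z * V) 0 0 =
      ((t + x * (2 * (star (V 0 0) * V 1 0).re) + y * (2 * (star (V 0 0) * V 1 0).im) +
        z * (Complex.normSq (V 0 0) - Complex.normSq (V 1 0)) : ℝ) : ℂ) := by
  rw [Complex.normSq_apply, Complex.normSq_apply] at hV
  apply Complex.ext
  · rw [Complex.ofReal_re]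
    simp [Matrix.mul_apply, Fin.sum_univ_two, pauliMatrix, Complex.normSq_apply]
    linear_combination t * hV
  · rw [Complex.ofReal_im]
    simp [Matrix.mul_apply, Fin.sum_univ_two, pauliMatrix]
    ring

theorem normSq_col_zero_of_mem_unitaryGroup {V : Matrix (Fin 2) (Fin 2) ℂ}
    (hV : V ∈ Matrix.unitaryGroup (Fin 2) ℂ) :
    Complex.normSq (V 0 0) + Complex.normSq (V 1 0) = 1 := by
  have h := congrArg Complex.re
    (congrFun (congrFun (Matrix.mem_unitaryGroup_iff'.1 hV) 0) 0)
  simpa [Matrix.star_eq_conjTranspose, Matrix.mul_apply, Fin.sum_univ_two,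
    Complex.normSq_apply] using h

/-- The special unitary matrix with first column `(p, q)`. -/
theorem mem_unitaryGroup_of_normSq_add {p q : ℂ} (h : Complex.normSq p + Complex.normSq q = 1) :
    !![p, -star q; q, star p] ∈ Matrix.unitaryGroup (Fin 2) ℂ := by
  rw [Complex.normSq_apply, Complex.normSq_apply] at h
  rw [Matrix.mem_unitaryGroup_iff', Matrix.star_eq_conjTranspose]
  ext i j
  fin_cases i <;> fin_cases j <;> apply Complex.ext <;>
    simp [Matrix.mul_apply, Fin.sum_univ_two] <;> linarith

theorem conjTranspose_mul_sub_one_mul_apply_eq_zero {A U V : Matrix (Fin 2) (Fin 2) ℂ}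
    (hU : U ∈ Matrix.unitaryGroup (Fin 2) ℂ) (hV : V ∈ Matrix.unitaryGroup (Fin 2) ℂ)
    (ht : (Uᴴ * A * V).BlockTriangular id) (hd : ∀ j, (Uᴴ * A * V) j j = 1) :
    (Vᴴ * (Aᴴ * A - 1) * V) 0 0 = 0 := by
  have hU' := Matrix.mem_unitaryGroup_iff.1 hU
  have hV' := Matrix.mem_unitaryGroup_iff'.1 hV
  rw [Matrix.star_eq_conjTranspose] at hU' hV'
  have key : Vᴴ * (Aᴴ * A - 1) * V = (Uᴴ * A * V)ᴴ * (Uᴴ * A * V) - 1 := by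
    calc Vᴴ * (Aᴴ * A - 1) * V = Vᴴ * (Aᴴ * 1 * A) * V - Vᴴ * V := by noncomm_ring
      _ = Vᴴ * (Aᴴ * (U * Uᴴ) * A) * V - 1 := by rw [hU', hV']
      _ = _ := by simp only [Matrix.conjTranspose_mul, Matrix.conjTranspose_conjTranspose,
                    Matrix.mul_assoc]
  have h10 : (Uᴴ * A * V) 1 0 = 0 := ht (by decide)
  rw [key, Matrix.sub_apply, Matrix.mul_apply, Fin.sum_univ_two]
  simp only [Matrix.conjTranspose_apply, hd, h10]
  simp

theorem exists_unitary_blockTriangular {A V : Matrix (Fin 2) (Fin 2) ℂ} (hA : A.det = 1)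
    (hV : V ∈ Matrix.unitaryGroup (Fin 2) ℂ) (hdet : V.det = 1)
    (h : (Vᴴ * (Aᴴ * A - 1) * V) 0 0 = 0) :
    ∃ U ∈ Matrix.unitaryGroup (Fin 2) ℂ,
      (Uᴴ * A * V).BlockTriangular id ∧ ∀ j, (Uᴴ * A * V) j j = 1 := by
  have hV' := Matrix.mem_unitaryGroup_iff'.1 hV
  rw [Matrix.star_eq_conjTranspose] at hV'
  obtain ⟨B, hB⟩ : ∃ B, B = A * V := ⟨_, rfl⟩
  have hBB : (Bᴴ * B) 0 0 = 1 := by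
    have : Vᴴ * (Aᴴ * A - 1) * V = Bᴴ * B - Vᴴ * V := by
      rw [hB, Matrix.conjTranspose_mul]; noncomm_ring
    rw [this, hV', Matrix.sub_apply, sub_eq_zero] at h
    simpa using h
  have hBdet : B.det = 1 := by rw [hB, Matrix.det_mul, hA, hdet, one_mul]
  rw [Matrix.mul_apply, Fin.sum_univ_two, Matrix.conjTranspose_apply,
    Matrix.conjTranspose_apply] at hBB
  have hn : Complex.normSq (B 0 0) + Complex.normSq (B 1 0) = 1 := by
    simpa [Complex.normSq_apply] using congrArg Complex.re hBB
  rw [Matrix.det_fin_two] at hBdet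
  refine ⟨!![B 0 0, -star (B 1 0); B 1 0, star (B 0 0)], mem_unitaryGroup_of_normSq_add hn, ?_⟩
  rw [Matrix.mul_assoc, ← hB]
  constructor
  · intro i j hij
    fin_cases i <;> fin_cases j <;> simp at hij
    simp [Matrix.mul_apply, Fin.sum_univ_two]
    ring
  · intro j
    fin_cases j
    · simpa [Matrix.mul_apply, Fin.sum_univ_two] using hBB
    · simp [Matrix.mul_apply, Fin.sum_univ_two]
      linear_combination hBdet

/-- Surjectivity of the Hopf map `S³ → S²`. -/
theorem exists_hopf_preimage {a b c : ℝ} (h : a ^ 2 + b ^ 2 + c ^ 2 = 1) :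
    ∃ p q : ℂ, Complex.normSq p + Complex.normSq q = 1 ∧ 2 * (star p * q).re = a ∧
      2 * (star p * q).im = b ∧ Complex.normSq p - Complex.normSq q = c := by
  by_cases hc : c = -1
  · subst hc
    have ha : a = 0 := by nlinarith [sq_nonneg a, sq_nonneg b]
    have hb : b = 0 := by nlinarith [sq_nonneg a, sq_nonneg b]
    exact ⟨0, 1, by simp [ha, hb]⟩
  · have hc' : 0 < (1 + c) / 2 := by
      have : -1 < c := lt_of_le_of_ne (by nlinarith [sq_nonneg a, sq_nonneg b]) (Ne.symm hc)
      linarith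
    obtain ⟨r, hr, hrc⟩ : ∃ r : ℝ, 0 < r ∧ r ^ 2 = (1 + c) / 2 :=
      ⟨_, Real.sqrt_pos.2 hc', Real.sq_sqrt hc'.le⟩
    have hq : (a / (2 * r)) * (a / (2 * r)) + (b / (2 * r)) * (b / (2 * r)) = (1 - c) / 2 := by
      field_simp
      rw [hrc]
      linarith
    refine ⟨r, ⟨a / (2 * r), b / (2 * r)⟩, ?_, ?_, ?_, ?_⟩
    · simp only [Complex.normSq_apply, Complex.ofReal_re, Complex.ofReal_im, hq]; linarith
    · simp; field_simp
    · simp; field_simp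
    · simp only [Complex.normSq_apply, Complex.ofReal_re, Complex.ofReal_im, hq]; linarith

theorem eq_zero_of_sum_three_sq_nonpos {x y z : ℝ} (h : x ^ 2 + y ^ 2 + z ^ 2 ≤ 0) :
    x = 0 ∧ y = 0 ∧ z = 0 := by
  have hx := sq_nonneg x
  have hy := sq_nonneg y
  have hz := sq_nonneg z
  exact ⟨sq_eq_zero_iff.1 (by linarith), sq_eq_zero_iff.1 (by linarith),
    sq_eq_zero_iff.1 (by linarith)⟩

/-- A plane at distance at most one from the origin meets the unit sphere. -/
theorem exists_unit_mem_plane {t x y z : ℝ} (ht : 0 ≤ t)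
    (h : x ^ 2 + y ^ 2 + z ^ 2 = t ^ 2 + 2 * t) :
    ∃ a b c : ℝ, a ^ 2 + b ^ 2 + c ^ 2 = 1 ∧ t + x * a + y * b + z * c = 0 := by
  rcases ht.eq_or_lt with rfl | ht
  · obtain ⟨hx, -, -⟩ := eq_zero_of_sum_three_sq_nonpos (h.trans_le (by norm_num))
    exact ⟨1, 0, 0, by norm_num, by simp [hx]⟩
  obtain ⟨u, v, w, hperp, hpos⟩ :
      ∃ u v w : ℝ, x * u + y * v + z * w = 0 ∧ 0 < u ^ 2 + v ^ 2 + w ^ 2 := by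
    by_cases hx : x = 0
    · exact ⟨1, 0, 0, by simp [hx], by norm_num⟩
    · exact ⟨-y, x, 0, by ring, by positivity⟩
  have hk : 0 ≤ 2 / (t + 2) / (u ^ 2 + v ^ 2 + w ^ 2) := by positivity
  obtain ⟨k, hk⟩ : ∃ k : ℝ, k ^ 2 = 2 / (t + 2) / (u ^ 2 + v ^ 2 + w ^ 2) :=
    ⟨_, Real.sq_sqrt hk⟩
  have hk' : k ^ 2 * (u ^ 2 + v ^ 2 + w ^ 2) = 2 / (t + 2) := by rw [hk]; field_simp
  have ht2 : t + 2 ≠ 0 := by positivity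
  have hm : (t + 2)⁻¹ * (t + 2) = 1 := inv_mul_cancel₀ ht2
  rw [div_eq_mul_inv] at hk'
  generalize (t + 2)⁻¹ = m at hm hk'
  refine ⟨-m * x + k * u, -m * y + k * v, -m * z + k * w, ?_, ?_⟩
  · linear_combination hk' + m ^ 2 * h - 2 * m * k * hperp + (1 + m * t) * hm
  · linear_combination -m * h + k * hperp - t * hm

theorem exists_unit_mem_planes {t₁ x₁ y₁ z₁ t₂ x₂ y₂ z₂ : ℝ} (ht₁ : 0 ≤ t₁) (ht₂ : 0 ≤ t₂)
    (h₁ : x₁ ^ 2 + y₁ ^ 2 + z₁ ^ 2 = t₁ ^ 2 + 2 * t₁)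
    (h₂ : x₂ ^ 2 + y₂ ^ 2 + z₂ ^ 2 = t₂ ^ 2 + 2 * t₂)
    (h : (t₂ * x₁ - t₁ * x₂) ^ 2 + (t₂ * y₁ - t₁ * y₂) ^ 2 + (t₂ * z₁ - t₁ * z₂) ^ 2 ≤
      (y₁ * z₂ - z₁ * y₂) ^ 2 + (z₁ * x₂ - x₁ * z₂) ^ 2 + (x₁ * y₂ - y₁ * x₂) ^ 2) :
    ∃ a b c : ℝ, a ^ 2 + b ^ 2 + c ^ 2 = 1 ∧ t₁ + x₁ * a + y₁ * b + z₁ * c = 0 ∧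
      t₂ + x₂ * a + y₂ * b + z₂ * c = 0 := by
  obtain ⟨u, hu⟩ : ∃ u, u = y₁ * z₂ - z₁ * y₂ := ⟨_, rfl⟩
  obtain ⟨v, hv⟩ : ∃ v, v = z₁ * x₂ - x₁ * z₂ := ⟨_, rfl⟩
  obtain ⟨w, hw⟩ : ∃ w, w = x₁ * y₂ - y₁ * x₂ := ⟨_, rfl⟩
  rw [← hu, ← hv, ← hw] at h
  have hN : 0 ≤ u ^ 2 + v ^ 2 + w ^ 2 := by positivity
  rcases hN.eq_or_lt with hN | hN
  · rw [← hN] at h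
    obtain ⟨hx, hy, hz⟩ := eq_zero_of_sum_three_sq_nonpos h
    rcases ht₁.eq_or_lt with rfl | ht₁
    · obtain ⟨a, b, c, habc, hp⟩ := exists_unit_mem_plane ht₂ h₂
      obtain ⟨hx₁, hy₁, hz₁⟩ := eq_zero_of_sum_three_sq_nonpos (h₁.trans_le (by norm_num))
      exact ⟨a, b, c, habc, by simp [hx₁, hy₁, hz₁], hp⟩
    · obtain ⟨a, b, c, habc, hp⟩ := exists_unit_mem_plane ht₁.le h₁
      refine ⟨a, b, c, habc, hp, ?_⟩
      apply mul_left_cancel₀ ht₁.ne'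
      linear_combination t₂ * hp - a * hx - b * hy - c * hz
  · have hm : (u ^ 2 + v ^ 2 + w ^ 2)⁻¹ * (u ^ 2 + v ^ 2 + w ^ 2) = 1 := inv_mul_cancel₀ hN.ne'
    generalize (u ^ 2 + v ^ 2 + w ^ 2)⁻¹ = m at hm
    obtain ⟨D, hD⟩ : ∃ D, D = (t₂ * x₁ - t₁ * x₂) ^ 2 + (t₂ * y₁ - t₁ * y₂) ^ 2 +
      (t₂ * z₁ - t₁ * z₂) ^ 2 := ⟨_, rfl⟩
    rw [← hD] at h
    obtain ⟨k, hk⟩ : ∃ k : ℝ, k ^ 2 = m ^ 2 * (u ^ 2 + v ^ 2 + w ^ 2 - D) :=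
      ⟨_, Real.sq_sqrt (mul_nonneg (sq_nonneg m) (sub_nonneg.2 h))⟩
    have hperp₁ : x₁ * u + y₁ * v + z₁ * w = 0 := by rw [hu, hv, hw]; ring
    have hperp₂ : x₂ * u + y₂ * v + z₂ * w = 0 := by rw [hu, hv, hw]; ring
    obtain ⟨f, hf⟩ : ∃ f, f = t₂ * x₁ - t₁ * x₂ := ⟨_, rfl⟩
    obtain ⟨g, hg⟩ : ∃ g, g = t₂ * y₁ - t₁ * y₂ := ⟨_, rfl⟩
    obtain ⟨e, he⟩ : ∃ e, e = t₂ * z₁ - t₁ * z₂ := ⟨_, rfl⟩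
    have hperp : f * u + g * v + e * w = 0 := by
      rw [hf, hg, he]; linear_combination t₂ * hperp₁ - t₁ * hperp₂
    rw [← hf, ← hg, ← he] at hD
    refine ⟨m * (g * w - e * v) + k * u, m * (e * u - f * w) + k * v,
      m * (f * v - g * u) + k * w, ?_, ?_, ?_⟩
    · have hsq : (g * w - e * v) ^ 2 + (e * u - f * w) ^ 2 + (f * v - g * u) ^ 2 =
          D * (u ^ 2 + v ^ 2 + w ^ 2) := by
        rw [hD]; linear_combination -(f * u + g * v + e * w) * hperp
      linear_combination m ^ 2 * hsq + (u ^ 2 + v ^ 2 + w ^ 2) * hk +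
        (m * (u ^ 2 + v ^ 2 + w ^ 2) + 1) * hm
    · have : x₁ * (g * w - e * v) + y₁ * (e * u - f * w) + z₁ * (f * v - g * u) =
          -t₁ * (u ^ 2 + v ^ 2 + w ^ 2) := by
        rw [hf, hg, he, hu, hv, hw]; ring
      linear_combination m * this + k * hperp₁ - t₁ * hm
    · have : x₂ * (g * w - e * v) + y₂ * (e * u - f * w) + z₂ * (f * v - g * u) =
          -t₂ * (u ^ 2 + v ^ 2 + w ^ 2) := by
        rw [hf, hg, he, hu, hv, hw]; ring
      linear_combination m * this + k * hperp₂ - t₂ * hm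

/-- If two planes share a point `(a, b, c)` of the unit sphere, their line of intersection is at
distance at most one from the origin. -/
theorem norm_le_norm_cross_of_unit_mem_planes {t₁ x₁ y₁ z₁ t₂ x₂ y₂ z₂ a b c : ℝ}
    (h : a ^ 2 + b ^ 2 + c ^ 2 = 1) (h₁ : t₁ + x₁ * a + y₁ * b + z₁ * c = 0)
    (h₂ : t₂ + x₂ * a + y₂ * b + z₂ * c = 0) :
    (t₂ * x₁ - t₁ * x₂) ^ 2 + (t₂ * y₁ - t₁ * y₂) ^ 2 + (t₂ * z₁ - t₁ * z₂) ^ 2 ≤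
      (y₁ * z₂ - z₁ * y₂) ^ 2 + (z₁ * x₂ - x₁ * z₂) ^ 2 + (x₁ * y₂ - y₁ * x₂) ^ 2 := by
  obtain rfl : t₁ = -(x₁ * a + y₁ * b + z₁ * c) := by linarith
  obtain rfl : t₂ = -(x₂ * a + y₂ * b + z₂ * c) := by linarith
  linear_combination sq_nonneg (a * (y₁ * z₂ - z₁ * y₂) + b * (z₁ * x₂ - x₁ * z₂) +
    c * (x₁ * y₂ - y₁ * x₂)) + ((y₁ * z₂ - z₁ * y₂) ^ 2 + (z₁ * x₂ - x₁ * z₂) ^ 2 +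
    (x₁ * y₂ - y₁ * x₂) ^ 2) * h

/-- **Existence of a perfect 2-GMD for `2 × 2` matrices.**
For complex `2 × 2` matrices `A₁, A₂` of unit determinant, there exist unitary matrices
`U₁, U₂, V` such that both `U₁ᴴ * A₁ * V` and `U₂ᴴ * A₂ * V` are upper triangular with both
diagonal entries equal to `1` iff `F₁(A₁ᴴA₁ − I, A₂ᴴA₂ − I) ≥ 0`. -/
theorem two_gmd_two_by_two (A₁ A₂ : Matrix (Fin 2) (Fin 2) ℂ)
    (h₁ : A₁.det = 1) (h₂ : A₂.det = 1) :
    (∃ U₁ U₂ V : Matrix (Fin 2) (Fin 2) ℂ,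
        U₁ ∈ Matrix.unitaryGroup (Fin 2) ℂ ∧ U₂ ∈ Matrix.unitaryGroup (Fin 2) ℂ ∧
        V ∈ Matrix.unitaryGroup (Fin 2) ℂ ∧
        (U₁ᴴ * A₁ * V).BlockTriangular id ∧ (∀ j, (U₁ᴴ * A₁ * V) j j = 1) ∧
        (U₂ᴴ * A₂ * V).BlockTriangular id ∧ (∀ j, (U₂ᴴ * A₂ * V) j j = 1)) ↔
      0 ≤ F1 (A₁ᴴ * A₁ - 1) (A₂ᴴ * A₂ - 1) := by
  obtain ⟨t₁, x₁, y₁, z₁, e₁, ht₁, hs₁⟩ :=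
    exists_conjTranspose_mul_self_sub_one_eq_pauliMatrix h₁
  obtain ⟨t₂, x₂, y₂, z₂, e₂, ht₂, hs₂⟩ :=
    exists_conjTranspose_mul_self_sub_one_eq_pauliMatrix h₂
  rw [e₁, e₂, F1_pauliMatrix, Complex.zero_le_real, mul_nonneg_iff_of_pos_left four_pos,
    sub_nonneg]
  constructor
  · rintro ⟨U₁, U₂, V, hU₁, hU₂, hV, hT₁, hD₁, hT₂, hD₂⟩
    have hn := normSq_col_zero_of_mem_unitaryGroup hV
    have k₁ := conjTranspose_mul_sub_one_mul_apply_eq_zero hU₁ hV hT₁ hD₁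
    have k₂ := conjTranspose_mul_sub_one_mul_apply_eq_zero hU₂ hV hT₂ hD₂
    rw [e₁, conjTranspose_mul_pauliMatrix_mul_apply_zero_zero _ _ _ _ _ hn,
      Complex.ofReal_eq_zero] at k₁
    rw [e₂, conjTranspose_mul_pauliMatrix_mul_apply_zero_zero _ _ _ _ _ hn,
      Complex.ofReal_eq_zero] at k₂
    refine norm_le_norm_cross_of_unit_mem_planes ?_ k₁ k₂
    rw [Complex.normSq_apply, Complex.normSq_apply] at hn
    simp [Complex.normSq_apply]
    linear_combination ((V 0 0).re * (V 0 0).re + (V 0 0).im * (V 0 0).im +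
      ((V 1 0).re * (V 1 0).re + (V 1 0).im * (V 1 0).im) + 1) * hn
  · intro h
    obtain ⟨a, b, c, habc, k₁, k₂⟩ := exists_unit_mem_planes ht₁ ht₂ hs₁ hs₂ h
    obtain ⟨p, q, hpq, rfl, rfl, rfl⟩ := exists_hopf_preimage habc
    have hV := mem_unitaryGroup_of_normSq_add hpq
    have hdet : (!![p, -star q; q, star p] : Matrix (Fin 2) (Fin 2) ℂ).det = 1 := by
      rw [Complex.normSq_apply, Complex.normSq_apply] at hpq
      rw [Matrix.det_fin_two_of]
      apply Complex.ext <;> simp <;> linarith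
    obtain ⟨U₁, hU₁, hT₁, hD₁⟩ := exists_unitary_blockTriangular h₁ hV hdet (by
      rw [e₁, conjTranspose_mul_pauliMatrix_mul_apply_zero_zero _ _ _ _ _ hpq]
      exact Complex.ofReal_eq_zero.2 k₁)
    obtain ⟨U₂, hU₂, hT₂, hD₂⟩ := exists_unitary_blockTriangular h₂ hV hdet (by
      rw [e₂, conjTranspose_mul_pauliMatrix_mul_apply_zero_zero _ _ _ _ _ hpq]
      exact Complex.ofReal_eq_zero.2 k₂)
    exact ⟨U₁, U₂, _, hU₁, hU₂, hV, hT₁, hD₁, hT₂, hD₂⟩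
end

section
/- Let A_1,…,A_K be complex n×n matrices with det A_k = 1 for all k, let N ≥ n^{K−1} be a natural number, and define the extended matrices 𝒜_k = I_N ⊗ A_k (the nN×nN block-diagonal matrix with N copies of A_k on the diagonal). Then there exist K+1 complex matrices 𝒰_1,…,𝒰_K, 𝒱, each of dimensions nN × n(N − (n^{K−1} − 1)) and each having orthonormal columns, such that for every k = 1,…,K the square matrix 𝒰_k† 𝒜_k 𝒱 of size n(N − (n^{K−1} − 1)) is upper-triangular with all diagonal entries equal to 1. -/
open Matrix

/-- The time-extended matrix `I_N ⊗ A`: the `nN × nN` block-diagonal matrix with `N` copies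
of the `n × n` matrix `A` on the diagonal, reindexed by `Fin (n * N)`. -/
noncomputable def timeExtend {n : ℕ} (N : ℕ) (A : Matrix (Fin n) (Fin n) ℂ) :
    Matrix (Fin (n * N)) (Fin (n * N)) ℂ :=
  Matrix.reindex finProdFinEquiv finProdFinEquiv
    (Matrix.blockDiagonal fun _ : Fin N => A)

open InnerProductSpace

lemma Multiset.exists_one_le_norm {s : Multiset ℂ} (hs : s ≠ 0) (h : ‖s.prod‖ = 1) :
    ∃ r ∈ s, 1 ≤ ‖r‖ := by
  by_contra! hlt
  obtain ⟨a, ha⟩ := Multiset.exists_mem_of_ne_zero hs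
  obtain ⟨t, rfl⟩ := Multiset.exists_cons_of_mem ha
  have ht : ‖t.prod‖ ≤ 1 := by
    refine Multiset.prod_induction (fun z : ℂ => ‖z‖ ≤ 1) t (fun x y hx hy => ?_) (by simp)
      fun x hx => (hlt x (Multiset.mem_cons_of_mem hx)).le
    simpa using mul_le_one₀ hx (norm_nonneg y) hy
  rw [Multiset.prod_cons, norm_mul] at h
  nlinarith [hlt a ha, norm_nonneg a, norm_nonneg t.prod]

lemma Multiset.exists_norm_le_one {s : Multiset ℂ} (hs : s ≠ 0) (h : ‖s.prod‖ = 1) :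
    ∃ r ∈ s, ‖r‖ ≤ 1 := by
  by_contra! hlt
  obtain ⟨r, hr, hr1⟩ := Multiset.exists_one_le_norm (s := s.map (·⁻¹)) (by simpa using hs)
    (by rw [Multiset.prod_map_inv, Multiset.map_id', norm_inv, h, inv_one])
  obtain ⟨a, ha, rfl⟩ := Multiset.mem_map.1 hr
  rw [norm_inv] at hr1
  exact absurd (inv_lt_one_of_one_lt₀ (hlt a ha)) hr1.not_gt

lemma Matrix.exists_unit_eigenvector {n : ℕ} (B : Matrix (Fin n) (Fin n) ℂ) {r : ℂ}
    (hr : r ∈ B.charpoly.roots) :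
    ∃ v : EuclideanSpace ℂ (Fin n), ‖v‖ = 1 ∧ ‖toEuclideanLin B v‖ = ‖r‖ := by
  have h0 : (scalar (Fin n) r - B).det = 0 := by
    rw [← eval_charpoly]; exact (Polynomial.mem_roots'.1 hr).2
  obtain ⟨w, hw, hBw⟩ := exists_mulVec_eq_zero_iff.2 h0
  have hw' : WithLp.toLp 2 w ≠ 0 := by simpa using hw
  have hB : toEuclideanLin B (WithLp.toLp 2 w) = r • WithLp.toLp 2 w := by
    rw [sub_mulVec, sub_eq_zero] at hBw
    ext i
    have := congrFun hBw i
    simp only [scalar_apply, mulVec_diagonal] at this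
    simpa [toLpLin_apply] using this.symm
  refine ⟨((‖WithLp.toLp 2 w‖⁻¹ : ℝ) : ℂ) • WithLp.toLp 2 w, ?_, ?_⟩
  · rw [norm_smul]; simp [hw]
  · rw [map_smul, hB, norm_smul, norm_smul]
    simp only [Complex.norm_real, norm_inv, norm_norm]
    field_simp [norm_ne_zero_iff.2 hw']

lemma Matrix.exists_norm_toEuclideanLin_eq_one {n : ℕ} (B : Matrix (Fin (n + 1)) (Fin (n + 1)) ℂ)
    (hB : ‖B.det‖ = 1) :
    ∃ v : EuclideanSpace ℂ (Fin (n + 1)), ‖v‖ = 1 ∧ ‖toEuclideanLin B v‖ = 1 := by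
  rw [det_eq_prod_roots_charpoly] at hB
  have hs : B.charpoly.roots ≠ 0 := by
    rw [← Multiset.card_pos, ← (IsAlgClosed.splits B.charpoly).natDegree_eq_card_roots,
      charpoly_natDegree_eq_dim]
    simp
  obtain ⟨r, hr, hr1⟩ := Multiset.exists_norm_le_one hs hB
  obtain ⟨t, ht, ht1⟩ := Multiset.exists_one_le_norm hs hB
  obtain ⟨v, hv, hv1⟩ := B.exists_unit_eigenvector hr
  obtain ⟨w, hw, hw1⟩ := B.exists_unit_eigenvector ht
  have hrank : 1 < Module.rank ℝ (EuclideanSpace ℂ (Fin (n + 1))) := by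
    rw [← Module.finrank_eq_rank, ← Module.finrank_mul_finrank ℝ ℂ]
    simp only [Complex.finrank_real_complex, finrank_euclideanSpace, Fintype.card_fin]
    norm_cast; omega
  have hc : Continuous fun x => ‖toEuclideanLin B x‖ :=
    (LinearMap.continuous_of_finiteDimensional (toEuclideanLin B)).norm
  obtain ⟨x, hx, hx1⟩ := (isPreconnected_sphere hrank 0 1).intermediate_value
    (mem_sphere_zero_iff_norm.2 hv) (mem_sphere_zero_iff_norm.2 hw) hc.continuousOn
    (show (1 : ℝ) ∈ _ from ⟨hv1.trans_le hr1, ht1.trans_eq hw1.symm⟩)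
  exact ⟨x, mem_sphere_zero_iff_norm.1 hx, hx1⟩

lemma OrthonormalBasis.of_ofLp_mem_unitaryGroup {n : ℕ}
    (b : OrthonormalBasis (Fin n) ℂ (EuclideanSpace ℂ (Fin n))) :
    (Matrix.of fun i j => b j i) ∈ unitaryGroup (Fin n) ℂ := by
  rw [mem_unitaryGroup_iff', star_eq_conjTranspose]
  ext i j
  have := orthonormal_iff_ite.1 b.orthonormal i j
  rw [EuclideanSpace.inner_eq_star_dotProduct] at this
  simpa [mul_apply, one_apply, dotProduct, mul_comm] using this

/-- QR decomposition. -/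
lemma Matrix.exists_unitary_conjTranspose_mul_blockTriangular {n : ℕ}
    (B : Matrix (Fin n) (Fin n) ℂ) :
    ∃ U ∈ unitaryGroup (Fin n) ℂ, (Uᴴ * B).BlockTriangular id := by
  let f : Fin n → EuclideanSpace ℂ (Fin n) := fun j => WithLp.toLp 2 (B.col j)
  have hn : Module.finrank ℂ (EuclideanSpace ℂ (Fin n)) = Fintype.card (Fin n) := by simp
  refine ⟨_, (gramSchmidtOrthonormalBasis hn f).of_ofLp_mem_unitaryGroup, fun i j hij => ?_⟩
  have := gramSchmidtOrthonormalBasis_inv_triangular hn f (show j < i from hij)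
  rw [EuclideanSpace.inner_eq_star_dotProduct] at this
  simpa [mul_apply, dotProduct, f, mul_comm] using this

lemma Matrix.exists_unitary_col_zero {n : ℕ} (v : EuclideanSpace ℂ (Fin (n + 1)))
    (hv : ‖v‖ = 1) : ∃ U ∈ unitaryGroup (Fin (n + 1)) ℂ, ∀ i, U i 0 = v i := by
  have hn : Module.finrank ℂ (EuclideanSpace ℂ (Fin (n + 1))) = Fintype.card (Fin (n + 1)) := by
    simp
  have ho : Orthonormal ℂ (({0} : Set (Fin (n + 1))).domRestrict fun _ => v) := by
    refine ⟨fun i => hv, fun i j hij => absurd (Subsingleton.elim i j) hij⟩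
  obtain ⟨b, hb⟩ := ho.exists_orthonormalBasis_extension_of_card_eq hn
  exact ⟨_, b.of_ofLp_mem_unitaryGroup, fun i => by simp [hb 0 rfl]⟩

/-- The block-diagonal matrix with blocks `1` and `U`. -/
def Matrix.oneBlock {n : ℕ} (U : Matrix (Fin n) (Fin n) ℂ) :
    Matrix (Fin (n + 1)) (Fin (n + 1)) ℂ :=
  Matrix.of (Fin.cons (Fin.cons 1 0) fun i => Fin.cons 0 (U i))

lemma Matrix.oneBlock_mem_unitaryGroup {n : ℕ} {U : Matrix (Fin n) (Fin n) ℂ}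
    (hU : U ∈ unitaryGroup (Fin n) ℂ) : oneBlock U ∈ unitaryGroup (Fin (n + 1)) ℂ := by
  rw [mem_unitaryGroup_iff', star_eq_conjTranspose] at hU ⊢
  ext i j
  refine Fin.cases (Fin.cases ?_ (fun j => ?_) j) (fun i => Fin.cases ?_ (fun j => ?_) j) i
  · simp [mul_apply, Fin.sum_univ_succ, oneBlock]
  · simp [mul_apply, Fin.sum_univ_succ, oneBlock, Fin.ext_iff]
  · simp [mul_apply, Fin.sum_univ_succ, oneBlock, Fin.ext_iff]
  · have := congrFun (congrFun hU i) j
    simpa [mul_apply, Fin.sum_univ_succ, oneBlock, one_apply] using this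

lemma Matrix.norm_det_of_mem_unitaryGroup {n : ℕ} {U : Matrix (Fin n) (Fin n) ℂ}
    (hU : U ∈ unitaryGroup (Fin n) ℂ) : ‖U.det‖ = 1 :=
  CStarRing.norm_of_mem_unitary (det_of_mem_unitary hU)

lemma Matrix.norm_det_unitary_mul {n : ℕ} {U V : Matrix (Fin n) (Fin n) ℂ}
    (B : Matrix (Fin n) (Fin n) ℂ)
    (hU : U ∈ unitaryGroup (Fin n) ℂ) (hV : V ∈ unitaryGroup (Fin n) ℂ) :
    ‖(Uᴴ * B * V).det‖ = ‖B.det‖ := by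
  simp [det_conjTranspose, norm_det_of_mem_unitaryGroup hU, norm_det_of_mem_unitaryGroup hV]

/-- Geometric mean decomposition. -/
lemma Matrix.exists_gmd {n : ℕ} (B : Matrix (Fin n) (Fin n) ℂ) (hB : ‖B.det‖ = 1) :
    ∃ U ∈ unitaryGroup (Fin n) ℂ, ∃ V ∈ unitaryGroup (Fin n) ℂ,
      (Uᴴ * B * V).BlockTriangular id ∧ ∀ i, (Uᴴ * B * V) i i = 1 := by
  induction n with
  | zero => exact ⟨1, one_mem _, 1, one_mem _, fun i => i.elim0, fun i => i.elim0⟩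
  | succ n ih =>
    obtain ⟨v, hv, hBv⟩ := B.exists_norm_toEuclideanLin_eq_one hB
    obtain ⟨V, hV, hV0⟩ := exists_unitary_col_zero v hv
    obtain ⟨U, hU, hU0⟩ := exists_unitary_col_zero _ hBv
    set C := Uᴴ * B * V with hC
    have hBV : ∀ i, (B * V) i 0 = U i 0 := fun i => by
      simp [hU0, mul_apply, hV0, toLpLin_apply, mulVec, dotProduct]
    have hC0 : ∀ i, C i 0 = (1 : Matrix (Fin (n + 1)) (Fin (n + 1)) ℂ) i 0 := fun i => by
      rw [← mem_unitaryGroup_iff'.1 hU, hC, Matrix.mul_assoc, mul_apply, mul_apply]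
      exact Finset.sum_congr rfl fun j _ => by rw [hBV]; rfl
    have hdet : ‖(C.submatrix Fin.succ Fin.succ).det‖ = 1 := by
      rw [← hB, ← norm_det_unitary_mul B hU hV, ← hC, det_succ_column_zero C,
        Fin.sum_univ_succ, Finset.sum_eq_zero fun i _ => by simp [hC0]]
      simp [hC0, Fin.succAbove_zero]
    obtain ⟨U', hU', V', hV', ht, hd⟩ := ih _ hdet
    have key : (U * oneBlock U')ᴴ * B * (V * oneBlock V') = (oneBlock U')ᴴ * C * oneBlock V' := by
      simp only [hC, conjTranspose_mul, Matrix.mul_assoc]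
    have hss : ∀ i j, ((oneBlock U')ᴴ * C * oneBlock V') (Fin.succ i) (Fin.succ j) =
        (U'ᴴ * C.submatrix Fin.succ Fin.succ * V') i j := fun i j => by
      simp [mul_apply, Fin.sum_univ_succ, oneBlock]
    have h0 : ∀ i, ((oneBlock U')ᴴ * C * oneBlock V') i 0 =
        (1 : Matrix (Fin (n + 1)) (Fin (n + 1)) ℂ) i 0 := fun i => by
      refine Fin.cases ?_ (fun i => ?_) i <;>
        simp [mul_apply, Fin.sum_univ_succ, oneBlock, hC0, Fin.ext_iff]
    refine ⟨_, mul_mem hU (oneBlock_mem_unitaryGroup hU'), _,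
      mul_mem hV (oneBlock_mem_unitaryGroup hV'), ?_, ?_⟩
    · rw [key]
      intro i j hij
      induction j using Fin.cases with
      | zero => rw [h0]; exact one_apply_ne (ne_of_gt hij)
      | succ j =>
        induction i using Fin.cases with
        | zero => exact absurd hij (Fin.not_lt_zero _)
        | succ i => rw [hss]; exact ht (Fin.succ_lt_succ_iff.1 hij)
    · rw [key]
      intro i
      induction i using Fin.cases with
      | zero => rw [h0, one_apply_eq]
      | succ i => rw [hss, hd]

/-- `M` is block upper triangular with constant diagonal block `B`, and its nonzero blocks are
at offsets from the diagonal that are multiples of `m`. -/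
structure Matrix.IsBlockUpper {n N : ℕ} (M : Matrix (Fin N × Fin n) (Fin N × Fin n) ℂ)
    (m : ℕ) (B : Matrix (Fin n) (Fin n) ℂ) : Prop where
  support : ∀ s t, M.submatrix (Prod.mk s) (Prod.mk t) ≠ 0 → ∃ d : ℕ, (t : ℕ) = s + m * d
  diag : ∀ s, M.submatrix (Prod.mk s) (Prod.mk s) = B

/-- Compressing each `𝒜 k` by matrices with orthonormal columns, the right one being common to all
`k`, one obtains block upper triangular matrices with diagonal blocks `B k`. -/
def JointlyReducible {X : Type*} [Fintype X] {K n : ℕ} (𝒜 : Fin K → Matrix X X ℂ) (m N : ℕ)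
    (B : Fin K → Matrix (Fin n) (Fin n) ℂ) : Prop :=
  ∃ (U : Fin K → Matrix X (Fin N × Fin n) ℂ) (V : Matrix X (Fin N × Fin n) ℂ),
    (∀ k, (U k)ᴴ * U k = 1) ∧ Vᴴ * V = 1 ∧ ∀ k, ((U k)ᴴ * 𝒜 k * V).IsBlockUpper m (B k)

/-- All `B k` are upper triangular of determinant of modulus one, and the first `j` of them have
unit diagonal. -/
def UnitDiagonalUpTo {K n : ℕ} (j : ℕ) (B : Fin K → Matrix (Fin n) (Fin n) ℂ) : Prop :=
  ∀ k : Fin K, (B k).BlockTriangular id ∧ ‖(B k).det‖ = 1 ∧ ((k : ℕ) < j → ∀ i, B k i i = 1)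

lemma Matrix.conjTranspose_mul_self_submatrix {X Y Z : Type*} [Fintype X] [DecidableEq Y]
    [DecidableEq Z] {U : Matrix X Y ℂ} (hU : Uᴴ * U = 1) {f : Z → Y} (hf : f.Injective) :
    (U.submatrix id f)ᴴ * U.submatrix id f = 1 := by
  rw [← submatrix_one f hf, ← hU]; rfl

lemma JointlyReducible.conj {X : Type*} [Fintype X] {K n m N : ℕ} {𝒜 : Fin K → Matrix X X ℂ}
    {B : Fin K → Matrix (Fin n) (Fin n) ℂ} (h : JointlyReducible 𝒜 m N B)
    {P : Fin K → Matrix (Fin n) (Fin n) ℂ} {Q : Matrix (Fin n) (Fin n) ℂ}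
    (hP : ∀ k, P k ∈ unitaryGroup (Fin n) ℂ) (hQ : Q ∈ unitaryGroup (Fin n) ℂ) :
    JointlyReducible 𝒜 m N fun k => (P k)ᴴ * B k * Q := by
  obtain ⟨U, V, hU, hV, hM⟩ := h
  have hW : ∀ {Y : Matrix X (Fin N × Fin n) ℂ} {W : Matrix (Fin n) (Fin n) ℂ}, Yᴴ * Y = 1 →
      W ∈ unitaryGroup (Fin n) ℂ →
      (Y * kroneckerMap (· * ·) (1 : Matrix (Fin N) (Fin N) ℂ) W)ᴴ *
        (Y * kroneckerMap (· * ·) (1 : Matrix (Fin N) (Fin N) ℂ) W) = 1 := by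
    intro Y W hY hW
    rw [mem_unitaryGroup_iff', star_eq_conjTranspose] at hW
    rw [conjTranspose_mul, Matrix.mul_assoc, ← Matrix.mul_assoc Yᴴ, hY, Matrix.one_mul,
      conjTranspose_kronecker, ← mul_kronecker_mul, hW]
    simp
  have hblock : ∀ (M : Matrix (Fin N × Fin n) (Fin N × Fin n) ℂ) (W s t),
      ((kroneckerMap (· * ·) (1 : Matrix (Fin N) (Fin N) ℂ) W)ᴴ * M *
        kroneckerMap (· * ·) (1 : Matrix (Fin N) (Fin N) ℂ) Q).submatrix (Prod.mk s) (Prod.mk t) =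
      Wᴴ * M.submatrix (Prod.mk s) (Prod.mk t) * Q := by
    intro M W s t
    ext i j
    simp [mul_apply, Fintype.sum_prod_type, one_apply, apply_ite]
  refine ⟨_, _, fun k => hW (hU k) (hP k), hW hV hQ, fun k => ?_⟩
  rw [conjTranspose_mul, Matrix.mul_assoc, Matrix.mul_assoc, ← Matrix.mul_assoc (𝒜 k),
    ← Matrix.mul_assoc (U k)ᴴ, ← Matrix.mul_assoc (U k)ᴴ, ← Matrix.mul_assoc]
  refine ⟨fun s t hst => (hM k).support s t fun h0 => hst ?_, fun s => ?_⟩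
  · rw [hblock, h0, Matrix.mul_zero, Matrix.zero_mul]
  · rw [hblock, (hM k).diag]

lemma JointlyReducible.shift {X : Type*} [Fintype X] {K n p N N' : ℕ}
    {𝒜 : Fin K → Matrix X X ℂ} {B : Fin K → Matrix (Fin n) (Fin n) ℂ}
    (h : JointlyReducible 𝒜 (p * n) N B) (hB : ∀ k, (B k).BlockTriangular id) (hp : 0 < p)
    (hN : N' + p * (n - 1) ≤ N) :
    JointlyReducible 𝒜 p N' fun k => diagonal (B k).diag := by
  obtain ⟨U, V, hU, hV, hM⟩ := h
  have hlt : ∀ x : Fin N' × Fin n, (x.1 : ℕ) + p * (x.2.rev : ℕ) < N := fun x => by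
    have := Nat.mul_le_mul_left p (Nat.le_pred_of_lt x.2.rev.isLt)
    have := x.1.isLt
    simp only [Nat.pred_eq_sub_one] at *
    omega
  let e : Fin N' × Fin n → Fin N × Fin n := fun x => (⟨x.1 + p * x.2.rev, hlt x⟩, x.2)
  have he : e.Injective := by
    rintro ⟨s, i⟩ ⟨t, j⟩ hst
    obtain ⟨h1, rfl⟩ := Prod.ext_iff.1 hst
    have h1 := congrArg Fin.val h1
    simp only [e, Nat.add_right_cancel_iff] at h1
    rw [Fin.ext h1]
  refine ⟨fun k => (U k).submatrix id e, V.submatrix id e,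
    fun k => conjTranspose_mul_self_submatrix (hU k) he, conjTranspose_mul_self_submatrix hV he,
    fun k => ?_⟩
  have hsub : ((U k).submatrix id e)ᴴ * 𝒜 k * V.submatrix id e =
      ((U k)ᴴ * 𝒜 k * V).submatrix e e := rfl
  rw [hsub]
  have hM := hM k
  generalize (U k)ᴴ * 𝒜 k * V = M at hM
  have hsupp : ∀ s i t j, M (s, i) (t, j) ≠ 0 → ∃ d : ℕ, (t : ℕ) = s + p * n * d :=
    fun s i t j h0 => hM.support s t fun h1 => h0 (congrFun (congrFun h1 i) j)
  have hdiag : ∀ s i j, M (s, i) (s, j) = B k i j := fun s i j =>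
    congrFun (congrFun (hM.diag s) i) j
  refine ⟨fun s t hst => ?_, fun s => ?_⟩
  · obtain ⟨i, j, hij⟩ : ∃ i j, M (e (s, i)) (e (t, j)) ≠ 0 := by
      by_contra! h0
      exact hst (ext h0)
    obtain ⟨d, hd⟩ := hsupp _ _ _ _ hij
    simp only at hd
    have hle : (j.rev : ℕ) ≤ i.rev + n * d := by
      rcases d.eq_zero_or_pos with rfl | hpos
      · have heq : (e (t, j)).1 = (e (s, i)).1 := Fin.ext (by simpa [e] using hd)
        have hij' : M ((e (s, i)).1, i) ((e (t, j)).1, j) ≠ 0 := hij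
        rw [heq, hdiag] at hij'
        have : i ≤ j := not_lt.1 fun hji => hij' (hB k hji)
        have := Fin.le_def.1 (Fin.rev_le_rev.2 this)
        omega
      · have := Nat.le_mul_of_pos_right n hpos
        have := j.rev.isLt
        omega
    refine ⟨i.rev + n * d - j.rev, ?_⟩
    obtain ⟨c, hc⟩ := Nat.exists_eq_add_of_le hle
    rw [hc, Nat.add_sub_cancel_left]
    have : p * (i.rev + n * d : ℕ) = p * (j.rev + c) := by rw [hc]
    rw [mul_add, mul_add, ← mul_assoc] at this
    omega
  · ext i j
    change M (e (s, i)) (e (s, j)) = diagonal (B k).diag i j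
    by_cases hij : i = j
    · subst hij
      rw [diagonal_apply_eq]
      exact hdiag _ i i
    · rw [diagonal_apply_ne _ hij]
      by_contra h0
      obtain ⟨d, hd⟩ := hsupp _ _ _ _ h0
      simp only at hd
      have h1 : (j.rev : ℕ) = i.rev + n * d := by
        apply Nat.eq_of_mul_eq_mul_left hp
        rw [mul_add, ← mul_assoc]
        omega
      rcases d.eq_zero_or_pos with rfl | hpos
      · exact hij (Fin.rev_injective (Fin.ext (by simpa using h1.symm)))
      · have := Nat.le_mul_of_pos_right n hpos
        have := j.rev.isLt
        omega

lemma exists_unitDiagonalUpTo_succ {K n j : ℕ} (hj : j < K) (B : Fin K → Matrix (Fin n) (Fin n) ℂ)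
    (hdet : ∀ k, ‖(B k).det‖ = 1) (hone : ∀ k : Fin K, (k : ℕ) < j → B k = 1) :
    ∃ (P : Fin K → Matrix (Fin n) (Fin n) ℂ) (Q : Matrix (Fin n) (Fin n) ℂ),
      (∀ k, P k ∈ unitaryGroup (Fin n) ℂ) ∧ Q ∈ unitaryGroup (Fin n) ℂ ∧
      UnitDiagonalUpTo (j + 1) fun k => (P k)ᴴ * B k * Q := by
  obtain ⟨P, hP, Q, hQ, ht, hd⟩ := (B ⟨j, hj⟩).exists_gmd (hdet _)
  have h : ∀ k : Fin K, ∃ W ∈ unitaryGroup (Fin n) ℂ, (Wᴴ * B k * Q).BlockTriangular id ∧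
      ((k : ℕ) < j + 1 → ∀ i, (Wᴴ * B k * Q) i i = 1) := by
    intro k
    rcases lt_trichotomy (k : ℕ) j with hk | hk | hk
    · have : Qᴴ * B k * Q = 1 := by
        rw [hone k hk, Matrix.mul_one]
        exact mem_unitaryGroup_iff'.1 hQ
      exact ⟨Q, hQ, by rw [this]; exact blockTriangular_one, fun _ i => by rw [this]; simp⟩
    · obtain rfl : k = ⟨j, hj⟩ := Fin.ext hk
      exact ⟨P, hP, ht, fun _ => hd⟩
    · obtain ⟨W, hW, hWt⟩ := exists_unitary_conjTranspose_mul_blockTriangular (B k * Q)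
      exact ⟨W, hW, by rwa [Matrix.mul_assoc], fun hk' => by omega⟩
  choose W hW hWt hWd using h
  exact ⟨W, Q, hW, hQ, fun k =>
    ⟨hWt k, (norm_det_unitary_mul _ (hW k) hQ).trans (hdet k), hWd k⟩⟩

lemma JointlyReducible.exists_unitDiagonal {X : Type*} [Fintype X] {K n L : ℕ} (hn : 0 < n)
    {𝒜 : Fin K → Matrix X X ℂ} (r j : ℕ) (hjr : j + r = K)
    (B : Fin K → Matrix (Fin n) (Fin n) ℂ) (h : JointlyReducible 𝒜 (n ^ r) (L + (n ^ r - 1)) B)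
    (hB : UnitDiagonalUpTo j B) : ∃ B' : Fin K → Matrix (Fin n) (Fin n) ℂ,
      JointlyReducible 𝒜 1 L B' ∧ UnitDiagonalUpTo K B' := by
  induction r generalizing j B with
  | zero => exact ⟨B, by simpa using h, by simpa [← hjr] using hB⟩
  | succ r ih =>
    have hp : 0 < n ^ r := pow_pos hn r
    have hN : L + (n ^ r - 1) + n ^ r * (n - 1) ≤ L + (n ^ (r + 1) - 1) := by
      rw [pow_succ, Nat.mul_sub, mul_one]
      have := Nat.le_mul_of_pos_right (n ^ r) hn
      omega
    have h' := h.shift (fun k => (hB k).1) hp hN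
    obtain ⟨P, Q, hP, hQ, hPQ⟩ := exists_unitDiagonalUpTo_succ (j := j) (by omega)
      (fun k => diagonal (B k).diag) (fun k => by
        rw [det_diagonal, ← (hB k).2.1, det_of_isUpperTriangular (hB k).1]; rfl) (fun k hk => by
        rw [← diagonal_one]; exact congrArg _ (funext ((hB k).2.2 hk)))
    exact ih (j + 1) (by omega) _ (h'.conj hP hQ) hPQ

lemma jointlyReducible_timeExtend {n K : ℕ} (A : Fin K → Matrix (Fin n) (Fin n) ℂ) (m N : ℕ) :
    JointlyReducible (fun k => timeExtend N (A k)) m N A := by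
  let f : Fin N × Fin n → Fin (n * N) := fun x => finProdFinEquiv x.swap
  have hf : f.Injective := finProdFinEquiv.injective.comp Prod.swap_injective
  let E : Matrix (Fin (n * N)) (Fin (n * N)) ℂ := 1
  have hone : Eᴴ * E = 1 := by simp [E]
  refine ⟨fun _ => E.submatrix id f, E.submatrix id f,
    fun _ => conjTranspose_mul_self_submatrix hone hf, conjTranspose_mul_self_submatrix hone hf,
    fun k => ?_⟩
  have hsub : (E.submatrix id f)ᴴ * timeExtend N (A k) * E.submatrix id f =
      (timeExtend N (A k)).submatrix f f := by
    change (Eᴴ * timeExtend N (A k) * E).submatrix f f = _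
    simp [E]
  rw [hsub]
  refine ⟨fun s t hst => ⟨0, ?_⟩, fun s => ?_⟩
  · by_contra hne
    refine hst (ext fun i j => ?_)
    have : s ≠ t := fun h => hne (by simp [h])
    simp [f, timeExtend, blockDiagonal_apply, this]
  · ext i j
    simp [f, timeExtend]

/-- **Nearly-optimal `K`-GMD.**
Let `A 0, …, A (K-1)` be complex `n × n` matrices of unit determinant and `N ≥ n^(K-1)`.
Then there exist `K + 1` matrices `𝒰 0, …, 𝒰 (K-1), 𝒱`, each of dimensions
`nN × n(N − (n^(K−1) − 1))` with orthonormal columns, such that each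
`(𝒰 k)ᴴ * (I_N ⊗ A k) * 𝒱` is upper triangular with all diagonal entries equal to `1`. -/
theorem nearly_optimal_kGMD {n K : ℕ} (A : Fin K → Matrix (Fin n) (Fin n) ℂ)
    (hdet : ∀ k, (A k).det = 1) (N : ℕ) (hN : n ^ (K - 1) ≤ N) :
    ∃ (U : Fin K → Matrix (Fin (n * N)) (Fin (n * (N - (n ^ (K - 1) - 1)))) ℂ)
      (V : Matrix (Fin (n * N)) (Fin (n * (N - (n ^ (K - 1) - 1)))) ℂ),
      (∀ k, (U k)ᴴ * U k = 1) ∧ Vᴴ * V = 1 ∧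
      ∀ k, ((U k)ᴴ * timeExtend N (A k) * V).BlockTriangular id ∧
        ∀ j, ((U k)ᴴ * timeExtend N (A k) * V) j j = 1 := by
  generalize hL : N - (n ^ (K - 1) - 1) = L
  have hN' : N = L + (n ^ (K - 1) - 1) := by omega
  have hinit : JointlyReducible (fun k => timeExtend N (A k)) (n ^ (K - 1))
      (L + (n ^ (K - 1) - 1)) A := by
    rw [← hN']; exact jointlyReducible_timeExtend A _ N
  obtain ⟨B, ⟨U, V, hU, hV, hM⟩, hB⟩ : ∃ B : Fin K → Matrix (Fin n) (Fin n) ℂ,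
      JointlyReducible (fun k => timeExtend N (A k)) 1 L B ∧ UnitDiagonalUpTo K B := by
    rcases K.eq_zero_or_pos with rfl | hK
    · exact ⟨A, by simpa using hinit, fun k => k.elim0⟩
    rcases n.eq_zero_or_pos with rfl | hn
    · refine ⟨A, ⟨fun _ => 0, 0, fun _ => ext fun x => x.2.elim0, ext fun x => x.2.elim0,
        fun k => ⟨fun s t h => (h (ext fun x => x.elim0)).elim, fun s => ext fun x => x.elim0⟩⟩,
        fun k => ⟨fun i => i.elim0, by simp [hdet], fun _ i => i.elim0⟩⟩
    obtain ⟨P, Q, hP, hQ, hPQ⟩ := exists_unitDiagonalUpTo_succ hK A (fun k => by simp [hdet])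
      (fun k hk => absurd hk (Nat.not_lt_zero _))
    exact JointlyReducible.exists_unitDiagonal hn (K - 1) 1 (by omega) _ (hinit.conj hP hQ) hPQ
  let g : Fin (n * L) ≃ Fin L × Fin n := (finCongr (mul_comm n L)).trans finProdFinEquiv.symm
  refine ⟨fun k => (U k).submatrix id g, V.submatrix id g,
    fun k => conjTranspose_mul_self_submatrix (hU k) g.injective,
    conjTranspose_mul_self_submatrix hV g.injective, fun k => ?_⟩
  have hsub : ((U k).submatrix id g)ᴴ * timeExtend N (A k) * V.submatrix id g =
      ((U k)ᴴ * timeExtend N (A k) * V).submatrix g g := rfl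
  rw [hsub]
  have hM := hM k
  generalize (U k)ᴴ * timeExtend N (A k) * V = M at hM
  have hdiag : ∀ s i j, M (s, i) (s, j) = B k i j := fun s i j =>
    congrFun (congrFun (hM.diag s) i) j
  refine ⟨fun x y hxy => ?_, fun x => ?_⟩
  · obtain ⟨⟨s, i⟩, rfl⟩ := g.symm.surjective x
    obtain ⟨⟨t, j⟩, rfl⟩ := g.symm.surjective y
    rw [submatrix_apply, g.apply_symm_apply, g.apply_symm_apply]
    have hlt : (j : ℕ) + n * t < i + n * s := by simpa [g, Fin.lt_def] using hxy
    by_contra h0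
    obtain ⟨d, hd⟩ := hM.support s t fun h1 => h0 (congrFun (congrFun h1 i) j)
    rcases d.eq_zero_or_pos with rfl | hpos
    · obtain rfl : t = s := Fin.ext (by simpa using hd)
      rw [hdiag] at h0
      exact h0 ((hB k).1 (Fin.lt_def.2 (by simpa using hlt)))
    · have := Nat.le_mul_of_pos_right n hpos
      have := i.isLt
      rw [hd, one_mul, mul_add] at hlt
      omega
  · exact (hdiag _ _ _).trans ((hB k).2.2 k.isLt _)
end
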